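/- Let b₁⋯b_{4g} ∈ 𝓡 and let t ≥ 0. If the word X = b_{2g+1}(b_{2g}b_{2g−1}⋯b₂)^t X₁ is irreducible, then the word Y = b_{2g+1}X₁ is also irreducible. -/

import Mathlib

namespace SG

/-- A letter of the alphabet `S± = {cᵢ^{±1}}`: `(i, true)` is `c_{i+1}`,
`(i, false)` is `c_{i+1}⁻¹`. -/
abbrev Letter (g : ℕ) := Fin (2*g) × Bool

/-- A word in the alphabet `S±`. -/
abbrev Word (g : ℕ) := List (Letter g)

/-- The surface relator `c₁c₂⋯c_{2g}c₁⁻¹c₂⁻¹⋯c_{2g}⁻¹` in the free group. -/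
def relator (g : ℕ) : FreeGroup (Fin (2*g)) :=
  (List.ofFn fun i : Fin (2*g) => FreeGroup.of i).prod *
  (List.ofFn fun i : Fin (2*g) => (FreeGroup.of i)⁻¹).prod

/-- The surface group with the symmetric presentation. -/
abbrev SurfaceGroup (g : ℕ) :=
  PresentedGroup ({relator g} : Set (FreeGroup (Fin (2*g))))

/-- The generator `c_{i+1}` of the surface group. -/
def gen (g : ℕ) (i : Fin (2*g)) : SurfaceGroup g := PresentedGroup.of i

/-- The inverse of a letter. -/
def invLetter (g : ℕ) (a : Letter g) : Letter g := (a.1, !a.2)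

/-- The group element represented by a letter. -/
def evalLetter (g : ℕ) (a : Letter g) : SurfaceGroup g :=
  if a.2 then gen g a.1 else (gen g a.1)⁻¹

/-- The group element represented by a word. -/
def eval (g : ℕ) (W : Word g) : SurfaceGroup g := (W.map (evalLetter g)).prod

/-- The formal inverse `x_n⁻¹ ⋯ x₁⁻¹` of a word `x₁ ⋯ x_n`. -/
def wordInv (g : ℕ) (W : Word g) : Word g := (W.map (invLetter g)).reverse

/-- Word length of a group element: the least `n` such that the element is a
product of `n` elements of `S ∪ S⁻¹`. -/
noncomputable def len (g : ℕ) (u : SurfaceGroup g) : ℕ :=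
  sInf {n | ∃ W : Word g, W.length = n ∧ eval g W = u}

/-- `conjLen g u v` is the minimum of `|x|` over conjugators `x` with `x⁻¹ux = v`. -/
noncomputable def conjLen (g : ℕ) (u v : SurfaceGroup g) : ℕ :=
  sInf {k | ∃ x : SurfaceGroup g, x⁻¹ * u * x = v ∧ len g x = k}

/-- The conjugator length function: `CL g n` is the least `N` such that any
conjugate `u, v` with `|u| + |v| ≤ n` admit a conjugator of length `≤ N`. -/
noncomputable def CL (g : ℕ) (n : ℕ) : ℕ :=
  sInf {N | ∀ u v : SurfaceGroup g,
    (∃ x : SurfaceGroup g, x⁻¹ * u * x = v) → len g u + len g v ≤ n →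
      conjLen g u v ≤ N}

/-- Rank of a letter in the ascending order
`c_{2g} ≺ ⋯ ≺ c₂ ≺ c₁ ≺ c₁⁻¹ ≺ c₂⁻¹ ≺ ⋯ ≺ c_{2g}⁻¹`. -/
def rank (g : ℕ) (a : Letter g) : ℕ :=
  if a.2 then (2*g - 1) - (a.1 : ℕ) else 2*g + (a.1 : ℕ)

/-- The strict order `≺` on letters. -/
def letterLt (g : ℕ) (a b : Letter g) : Prop := rank g a < rank g b

/-- The length-lexicographical order `≺` on words. -/
def wordLt (g : ℕ) (X Y : Word g) : Prop :=
  X.length < Y.length ∨ (X.length = Y.length ∧ List.Lex (letterLt g) X Y)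

/-- A word is irreducible if it is the `≺`-least word representing its element. -/
def IrreducibleWord (g : ℕ) (W : Word g) : Prop :=
  ∀ W' : Word g, eval g W' = eval g W → W' = W ∨ wordLt g W W'

/-- A word is cyclically irreducible if all its cyclic permutations are irreducible. -/
def CyclicallyIrreducibleWord (g : ℕ) (W : Word g) : Prop :=
  ∀ W' : Word g, List.IsRotated W W' → IrreducibleWord g W'

/-- A word is freely reduced if no letter is followed by its inverse. -/
def FreelyReduced (g : ℕ) (W : Word g) : Prop :=
  List.Chain' (fun a c => c ≠ invLetter g a) W

/-- The normal form of a group element: the `≺`-least word representing it. -/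
noncomputable def nf (g : ℕ) (x : SurfaceGroup g) : Word g := by
  classical
  exact if h : ∃ W : Word g, eval g W = x ∧ IrreducibleWord g W then h.choose else []

/-- The word `R = c₁c₂⋯c_{2g}c₁⁻¹c₂⁻¹⋯c_{2g}⁻¹`. -/
def Rword (g : ℕ) : Word g :=
  (List.ofFn fun i : Fin (2*g) => ((i, true) : Letter g)) ++
  (List.ofFn fun i : Fin (2*g) => ((i, false) : Letter g))

/-- `𝓡`: all cyclic permutations of `R` and of `R⁻¹`. -/
def RSet (g : ℕ) : Set (Word g) :=
  {W | List.IsRotated (Rword g) W ∨ List.IsRotated (wordInv g (Rword g)) W}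

/-- `seg g b i k` is the word `b_i b_{i+1} ⋯ b_{i+k-1}`. -/
def seg (g : ℕ) (b : ℕ → Letter g) (i k : ℕ) : Word g :=
  (List.range k).map fun j => b (i + j)

/-- `dseg g b i k` is the descending word `b_i b_{i-1} ⋯ b_{i-k+1}`
(indices taken modulo `4g`, using periodicity of `b`). -/
def dseg (g : ℕ) (b : ℕ → Letter g) (i k : ℕ) : Word g :=
  (List.range k).map fun j => b (i + 4*g - j)

/-- `b : ℕ → Letter g` is a `4g`-periodic (1-based) enumeration of the letters
`b₁, …, b_{4g}` of some word `b₁⋯b_{4g} ∈ 𝓡`. -/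
def RelSeq (g : ℕ) (b : ℕ → Letter g) : Prop :=
  (∀ i, b (i + 4*g) = b i) ∧ seg g b 1 (4*g) ∈ RSet g

/-- The `t`-th power `W^t` of a word. -/
def wpow (g : ℕ) (W : Word g) (t : ℕ) : Word g := (List.replicate t W).flatten

/-- A `k`-fractional relator: an initial segment of length `k` (with `2 ≤ k ≤ 4g`)
of some word in `𝓡`. -/
def IsFR (g : ℕ) (k : ℕ) (W : Word g) : Prop :=
  2 ≤ k ∧ k ≤ 4*g ∧ ∃ B ∈ RSet g, W = B.take k

/-- `IsLLFROcc g k W P F Q` : the factorization `W = P ++ F ++ Q` exhibits `F`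
as a `k`-locally longest fractional relator of `W`. -/
def IsLLFROcc (g : ℕ) (k : ℕ) (W P F Q : Word g) : Prop :=
  W = P ++ F ++ Q ∧ IsFR g k F ∧
  (∀ a, P.getLast? = some a → ¬ IsFR g (k+1) (a :: F)) ∧
  (∀ a, Q.head? = some a → ¬ IsFR g (k+1) (F ++ [a]))

/-- `W` contains a `k`-LLFR. -/
def HasLLFR (g : ℕ) (k : ℕ) (W : Word g) : Prop :=
  ∃ P F Q, IsLLFROcc g k W P F Q

/-- Length-lexicographical order on pairs of words. -/
def pairLt (g : ℕ) (p q : Word g × Word g) : Prop :=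
  wordLt g p.1 q.1 ∨ (p.1 = q.1 ∧ wordLt g p.2 q.2)

/-- A candidate for the reducing-subword pair of `(W₁, W₂)`. -/
def IsRSCand (g : ℕ) (W₁ W₂ C₁ C₂ : Word g) : Prop :=
  ∃ A B C' : Word g, W₁ = A ++ C₁ ∧ W₂ = C₂ ++ B ∧
    nf g (eval g (W₁ ++ W₂)) = A ++ C' ++ B

/-- `(C₁, C₂)` is the reducing-subword pair `rs(W₁, W₂)`: the `≺`-least candidate. -/
def IsRS (g : ℕ) (W₁ W₂ C₁ C₂ : Word g) : Prop :=
  IsRSCand g W₁ W₂ C₁ C₂ ∧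
  ∀ D₁ D₂ : Word g, IsRSCand g W₁ W₂ D₁ D₂ →
    (C₁ = D₁ ∧ C₂ = D₂) ∨ pairLt g (C₁, C₂) (D₁, D₂)

end SG


namespace SGP

/-- Arithmetic progression of letters. -/
def ap {R : Type} [Add R] (i d : R) : ℕ → List R
  | 0 => []
  | j+1 => i :: ap (i + d) d j

/-- Product of a word. -/
def ev {R H : Type} [Group H] (F : R → H) (l : List R) : H := (l.map F).prod

section basic
variable {R H : Type} [Group H] (F : R → H)

@[simp] theorem ev_nil : ev F [] = 1 := rfl
@[simp] theorem ev_cons (a : R) (l : List R) : ev F (a :: l) = F a * ev F l := by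
  simp [ev]
@[simp] theorem ev_append (l l' : List R) : ev F (l ++ l') = ev F l * ev F l' := by
  simp [ev]

variable [CommRing R]
theorem ap_length (i d : R) (j : ℕ) : (ap i d j).length = j := by
  induction j generalizing i with
  | zero => rfl
  | succ j ih => simp [ap, ih]

theorem ap_add (i d : R) (j k : ℕ) : ap i d (j + k) = ap i d j ++ ap (i + j * d) d k := by
  induction j generalizing i with
  | zero => simp [ap]
  | succ j ih =>
    rw [show j + 1 + k = (j + k) + 1 by omega]
    simp only [ap, ih, List.cons_append]
    congr 3
    push_cast; ring

theorem ap_succ_right (i d : R) (j : ℕ) : ap i d (j + 1) = ap i d j ++ [i + j * d] := by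
  rw [ap_add]; simp [ap]

theorem map_ap (c i d : R) (j : ℕ) :
    (ap i d j).map (fun k => c - k) = ap (c - i) (-d) j := by
  induction j generalizing i with
  | zero => rfl
  | succ j ih => simp only [ap, List.map_cons, ih]; congr 2; ring
end basic

/-- Abstract properties of the surface group. -/
structure SD (g : ℕ) (G : Type) [Group G] (A : ZMod (4*g) → G) : Prop where
  inv : ∀ i, A (i + 2*g) = (A i)⁻¹
  rel0 : ev A (ap 0 1 (4*g)) = 1
  gen : ∀ x : G, ∃ l : List (ZMod (4*g)), ev A l = x
  lift : ∀ (H : Type) [Group H] (F : ZMod (4*g) → H), (∀ i, F (i + 2*g) = (F i)⁻¹) →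
    ev F (ap 0 1 (4*g)) = 1 → ∃ φ : G →* H, ∀ i, φ (A i) = F i

theorem h4 (g : ℕ) : (4 : ZMod (4*g)) * g = 0 := by
  have := ZMod.natCast_self (4*g)
  push_cast at this
  exact this

section inv
variable {g : ℕ} {H : Type} [Group H] {F : ZMod (4*g) → H}

theorem inv_ap (hF : ∀ i, F (i + 2*g) = (F i)⁻¹) (i d : ZMod (4*g)) (j : ℕ) :
    (ev F (ap i d j))⁻¹ = ev F (ap (i + j*d - d + 2*g) (-d) j) := by
  induction j generalizing i with
  | zero => simp [ap]
  | succ j ih =>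
    rw [ap_succ_right (i + _ - _ + _)]
    simp only [ap, ev_cons, mul_inv_rev, ev_append, ev_nil, mul_one, ih]
    congr 1
    · congr 2; push_cast; ring
    · rw [← hF]; congr 1; push_cast; ring

theorem rel_all (hg : 0 < g) (h : ev F (ap 0 1 (4*g)) = 1) (i : ZMod (4*g)) :
    ev F (ap i 1 (4*g)) = 1 := by
  have : NeZero (4*g) := ⟨by omega⟩
  have step : ∀ i : ZMod (4*g), ev F (ap i 1 (4*g)) = 1 → ev F (ap (i+1) 1 (4*g)) = 1 := by
    intro i hi
    obtain ⟨k, hk⟩ : ∃ k, 4*g = k+1 := ⟨4*g-1, by omega⟩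
    have hk' : (k : ZMod (4*g)) + 1 = 0 := by
      have := ZMod.natCast_self (4*g)
      conv at this => lhs; arg 1; rw [hk]
      push_cast at this; exact this
    rw [show ap i 1 (4*g) = ap i 1 (k+1) by rw [← hk]] at hi
    rw [show ap (i+1) 1 (4*g) = ap (i+1) 1 (k+1) by rw [← hk]]
    rw [ap_succ_right]
    simp only [ap, ev_cons, ev_append, ev_nil, mul_one] at hi ⊢
    rw [show i + 1 + (k : ZMod (4*g)) = i by linear_combination hk']
    rw [eq_inv_of_mul_eq_one_right hi]; simp
  have : ∀ n : ℕ, ev F (ap (n : ZMod (4*g)) 1 (4*g)) = 1 := by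
    intro n
    induction n with
    | zero => simpa using h
    | succ n ih => push_cast; exact step _ ih
  have h2 := this i.val
  rwa [ZMod.natCast_zmod_val] at h2

theorem ap4 (i : ZMod (4*g)) : ap i 1 (4*g) = ap i 1 (2*g) ++ ap (i + 2*g) 1 (2*g) := by
  have h := ap_add i 1 (2*g) (2*g)
  have e : 2*g + 2*g = 4*g := by ring
  have h' : ap i 1 (2*g+2*g) = ap i 1 (4*g) := congrArg (ap i 1) e
  rw [← h', h]
  push_cast
  rw [mul_one]

theorem half_desc (hg : 0 < g) (hF : ∀ i, F (i + 2*g) = (F i)⁻¹)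
    (h : ev F (ap 0 1 (4*g)) = 1) (i : ZMod (4*g)) :
    ev F (ap (i + 2*g) (-1) (2*g)) = ev F (ap (i+1) 1 (2*g)) := by
  have h1 := rel_all hg h (i+1)
  rw [ap4, ev_append] at h1
  rw [eq_inv_of_mul_eq_one_left h1, inv_ap hF]
  congr 2
  push_cast
  linear_combination (-1) * h4 g
end inv

section main
variable {g : ℕ} {G : Type} [Group G] {A : ZMod (4*g) → G}

theorem exists_alpha (hg : 0 < g) (S : SD g G A) (t : ZMod (4*g)) :
    ∃ α : G →* G, (∀ i, α (A i) = A (2*t + 2*g - i)) ∧ ∀ x, α (α x) = x := by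
  obtain ⟨α, hα⟩ := S.lift G (fun i => A (2*t+2*g-i)) (by
      intro i
      show A _ = (A _)⁻¹
      rw [← S.inv]; congr 1; linear_combination (-1) * h4 g) (by
      have : ∀ l : List (ZMod (4*g)), ev (fun i => A (2*t+2*g-i)) l =
          ev A (l.map (fun k => (2*t+2*g) - k)) := by
        intro l; simp [ev, Function.comp_def]
      rw [this, map_ap, ← inv_eq_one, inv_ap S.inv]
      rw [neg_neg]
      exact rel_all hg S.rel0 _)
  refine ⟨α, hα, ?_⟩
  have : α.comp α = MonoidHom.id G := by
    ext x
    obtain ⟨l, rfl⟩ := S.gen x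
    induction l with
    | nil => simp
    | cons a l ih =>
      simp only [ev_cons, map_mul, ih]
      congr 1
      simp [hα]
  intro x
  exact DFunLike.congr_fun this x

theorem alpha_ev {α : G →* G} {t : ZMod (4*g)} (hα : ∀ i, α (A i) = A (2*t + 2*g - i))
    (l : List (ZMod (4*g))) : α (ev A l) = ev A (l.map fun k => 2*t+2*g - k) := by
  induction l with
  | nil => simp
  | cons a l ih => simp [ih, hα]

/-- Sum of an edge cocycle along a path. -/
def cs (A : ZMod (4*g) → G) (c : G → ZMod (4*g) → ZMod 2) : G → List (ZMod (4*g)) → ZMod 2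
  | _, [] => 0
  | x, i :: l => c x i + cs A c (x * A i) l

theorem cs_append (c : G → ZMod (4*g) → ZMod 2) (x : G) (l l' : List (ZMod (4*g))) :
    cs A c x (l ++ l') = cs A c x l + cs A c (x * ev A l) l' := by
  induction l generalizing x with
  | nil => simp [cs]
  | cons a l ih => simp [cs, ih, mul_assoc, add_assoc]

theorem integrate (hg : 0 < g) (S : SD g G A) (c : G → ZMod (4*g) → ZMod 2)
    (hc : ∀ x i, c (x * A i) (i + 2*g) = c x i)
    (hc2 : ∀ x i, c (x * ev A (ap i 1 (2*g))) (i + 2*g) = c x i)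
    (l l' : List (ZMod (4*g))) (h : ev A l = ev A l') : cs A c 1 l = cs A c 1 l' := by
  have hinv := S.inv
  have h4g := h4 g
  have e4 : ∀ i : ZMod (4*g), i + 2*g + 2*g = i := fun i => by linear_combination h4g
  let π : ZMod (4*g) → Equiv.Perm (G × ZMod 2) := fun i =>
    { toFun := fun p => (p.1 * A i, p.2 + c p.1 i)
      invFun := fun p => (p.1 * A (i+2*g), p.2 + c p.1 (i+2*g))
      left_inv := by
        rintro ⟨x, e⟩
        simp only [hc, S.inv, mul_inv_cancel_right, add_assoc, CharTwo.add_self_eq_zero, add_zero]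
      right_inv := by
        rintro ⟨x, e⟩
        have := hc x (i+2*g)
        rw [e4] at this
        simp only [this, add_assoc, CharTwo.add_self_eq_zero, add_zero]
        simp [S.inv] }
  let F : ZMod (4*g) → Equiv.Perm (G × ZMod 2) := fun i => (π i)⁻¹
  have hF : ∀ i, F (i + 2*g) = (F i)⁻¹ := by
    intro i
    show (π (i+2*g))⁻¹ = (π i)⁻¹⁻¹
    rw [inv_inv, inv_eq_iff_eq_inv]
    ext1 p
    rfl
  have key : ∀ (l : List (ZMod (4*g))) x e, (ev F l)⁻¹ (x, e) = (x * ev A l, e + cs A c x l) := by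
    intro l
    induction l with
    | nil => intro x e; simp [cs]
    | cons a l ih =>
      intro x e
      rw [ev_cons, mul_inv_rev, Equiv.Perm.mul_apply]
      have : (F a)⁻¹ (x, e) = (x * A a, e + c x a) := by
        show ((π a)⁻¹)⁻¹ (x, e) = _
        rw [inv_inv]; rfl
      rw [this, ih]
      simp [cs, mul_assoc, add_assoc]
  have half : ∀ (j : ℕ) x i, cs A c (x * ev A (ap i 1 (2*g))) (ap (i+2*g) 1 j) =
      cs A c x (ap i 1 j) := by
    intro j
    induction j with
    | zero => intro x i; rfl
    | succ j ih =>
      intro x i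
      simp only [ap, cs, hc2]
      congr 1
      rw [← ih (x * A i) (i+1)]
      have : x * ev A (ap i 1 (2*g)) * A (i + 2*g) = x * A i * ev A (ap (i+1) 1 (2*g)) := by
        have h1 : ap i 1 (2*g+1) = i :: ap (i+1) 1 (2*g) := rfl
        have h2 := ap_succ_right i 1 (2*g)
        rw [h1] at h2
        have h3 := congrArg (ev A) h2
        simp only [ev_cons, ev_append, ev_nil, mul_one] at h3
        push_cast at h3
        rw [mul_assoc, mul_assoc, ← h3]
      rw [this]
      congr 2; ring
  have rel : ev F (ap 0 1 (4*g)) = 1 := by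
    rw [← inv_eq_one]
    ext1 ⟨x, e⟩
    rw [key, S.rel0, ap4, cs_append]
    have := half (2*g) x 0
    rw [mul_one, this, CharTwo.add_self_eq_zero]
    simp
  obtain ⟨φ, hφ⟩ := S.lift _ F hF rel
  have hφ' : ∀ l, φ (ev A l) = ev F l := by
    intro l
    induction l with
    | nil => simp
    | cons a l ih => simp [ih, hφ]
  have h1 := key l 1 0
  have h2 := key l' 1 0
  rw [← hφ', h, hφ', h2] at h1
  have := congrArg Prod.snd h1
  simpa using this.symm

/-- Geodesic words. -/
def Geo (A : ZMod (4*g) → G) (l : List (ZMod (4*g))) : Prop :=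
  ∀ l', ev A l' = ev A l → l.length ≤ l'.length

theorem cs_ne_zero (c : G → ZMod (4*g) → ZMod 2) (x : G) (l : List (ZMod (4*g)))
    (h : cs A c x l ≠ 0) : ∃ u i u', l = u ++ i :: u' ∧ c (x * ev A u) i ≠ 0 := by
  induction l generalizing x with
  | nil => simp [cs] at h
  | cons a l ih =>
    by_cases h1 : c x a = 0
    · simp only [cs, h1, zero_add] at h
      obtain ⟨u, i, u', rfl, h2⟩ := ih _ h
      exact ⟨a :: u, i, u', rfl, by simpa [mul_assoc] using h2⟩
    · exact ⟨[], a, l, rfl, by simpa using h1⟩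

theorem exchange (hg : 0 < g) (S : SD g G A) (w v : List (ZMod (4*g))) (t : ZMod (4*g))
    (hw : Geo A w) (hv : ev A (t :: v) = ev A w) (hl : (t :: v).length = w.length) :
    ∃ u i u', w = u ++ i :: u' ∧
      A t * ev A (u.map fun k => 2*t+2*g-k) = ev A u * A i := by
  classical
  obtain ⟨α, hα, hαα⟩ := exists_alpha hg S t
  have h4g := h4 g
  have hat : α (A t) = (A t)⁻¹ := by rw [hα, ← S.inv]; congr 1; ring
  let c : G → ZMod (4*g) → ZMod 2 := fun x i =>
    if (A t * α x = x * A i ∧ 2*i = 2*t) then 1 else 0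
  have hss : ∀ x y, A t * α x = y → A t * α y = x := by
    rintro x y rfl
    simp [hat, hαα]
  have hc : ∀ x i, c (x * A i) (i + 2*g) = c x i := by
    intro x i
    simp only [c]
    congr 1
    rw [S.inv, mul_inv_cancel_right]
    apply propext
    constructor
    · rintro ⟨h1, h2⟩
      exact ⟨hss _ _ h1, by linear_combination h2 - h4g⟩
    · rintro ⟨h1, h2⟩
      exact ⟨hss _ _ h1, by linear_combination h2 + h4g⟩
  have hh : ∀ x i, (A t * α x = x * A i ∧ 2*i = 2*t) →
      (A t * α (x * ev A (ap i 1 (2*g))) = (x * ev A (ap i 1 (2*g))) * A (i + 2*g) ∧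
        2*(i + 2*g) = 2*t) := by
    rintro x i ⟨h1, h2⟩
    refine ⟨?_, by linear_combination h2 + h4g⟩
    have h5 := ap_succ_right i 1 (2*g)
    rw [show ap i 1 (2*g+1) = i :: ap (i+1) 1 (2*g) from rfl] at h5
    have h3 := congrArg (ev A) h5
    simp only [ev_cons, ev_append, ev_nil, mul_one] at h3
    push_cast at h3
    rw [map_mul, ← mul_assoc, h1, alpha_ev hα, map_ap, mul_assoc, mul_assoc, ← h3]
    congr 2
    rw [← half_desc hg S.inv S.rel0]
    congr 2
    linear_combination -h2
  have hc2 : ∀ x i, c (x * ev A (ap i 1 (2*g))) (i + 2*g) = c x i := by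
    intro x i
    simp only [c]
    congr 1
    apply propext
    refine ⟨fun h => ?_, hh x i⟩
    have h1 := hh _ _ h
    have e4 : i + 2*g + 2*g = i := by linear_combination h4g
    rw [e4] at h1
    have h2 := rel_all hg S.rel0 i
    rw [ap4, ev_append] at h2
    rw [mul_assoc x, h2, mul_one] at h1
    exact ⟨h1.1, by linear_combination h1.2⟩
  have hcs := integrate hg S c hc hc2 _ _ hv
  have hct : c 1 t = 1 := by simp [c]
  have hz : cs A c (A t) v = 0 := by
    by_contra hne
    obtain ⟨u, i, u', rfl, h⟩ := cs_ne_zero c _ _ hne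
    have h1 : A t * α (A t * ev A u) = A t * ev A u * A i := by
      by_contra h2
      exact h (if_neg fun h3 => h2 h3.1)
    rw [map_mul, hat, alpha_ev hα, mul_inv_cancel_left] at h1
    have h2 := hw (u.map (fun k => 2*t+2*g-k) ++ u') (by
      rw [ev_append, h1, ← hv]; simp [mul_assoc])
    simp at h2 hl
    omega
  have h1 : cs A c 1 w = 1 := by
    rw [← hcs]; simp [cs, hct, hz]
  obtain ⟨u, i, u', rfl, h⟩ := cs_ne_zero c 1 w (by rw [h1]; decide)
  refine ⟨u, i, u', rfl, ?_⟩
  by_contra h2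
  rw [← alpha_ev hα] at h2
  exact h (by simp [c, h2])

/-- Images of generators of the Coxeter group under a retraction to a dihedral group. -/
def ff {g : ℕ} (m : ℕ) (s t k : ZMod (4*g)) : Equiv.Perm (ZMod m) :=
  if k = s then Equiv.neg _ else if k = t then Equiv.subLeft 1 else 1

theorem ff_sq {g : ℕ} (m : ℕ) (s t k : ZMod (4*g)) : ff m s t k * ff m s t k = 1 := by
  unfold ff
  ext1 x
  split_ifs <;> simp

theorem ff_order {g : ℕ} (m : ℕ) (s t k k' e : ZMod (4*g)) (he : e = 1 ∨ e = -1)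
    (hm : (2*g + s - t = 1 ∨ 2*g + s - t = -1) → ((2*g : ℕ) : ZMod m) = 0)
    (hk : k' = k + e * (1 + 2*g)) :
    (ff m s t k' * ff m s t k)^(2*g) = 1 := by
  have h4g := h4 g
  have inv : ∀ k, ff m s t k ^ (2*g) = 1 := by
    intro k; rw [pow_mul, pow_two, ff_sq, one_pow]
  by_cases hkk : k = k'
  · rw [hkk, ff_sq, one_pow]
  by_cases h1 : k = s ∨ k = t
  · by_cases h2 : k' = s ∨ k' = t
    · have hm0 : ((2*g : ℕ) : ZMod m) = 0 := by
        apply hm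
        rcases h1 with rfl | rfl <;> rcases h2 with rfl | rfl
        · exact absurd rfl hkk
        · rcases he with rfl | rfl
          · right; rw [hk]; ring
          · left; rw [hk]; linear_combination h4g
        · rcases he with rfl | rfl
          · left; rw [hk]; linear_combination h4g
          · right; rw [hk]; ring
        · exact absurd rfl hkk
      have tr : ∀ (a : ZMod m) (q : Equiv.Perm (ZMod m)), (∀ x, q x = x + a) →
          ∀ n : ℕ, ∀ x, (q^n) x = x + n * a := by
        intro a q hq n
        induction n with
        | zero => simp
        | succ n ih => intro x; rw [pow_succ, Equiv.Perm.mul_apply, hq, ih]; push_cast; ring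
      have fin : ∀ (a : ZMod m), (∀ x, (ff m s t k' * ff m s t k) x = x + a) →
          (ff m s t k' * ff m s t k)^(2*g) = 1 := by
        intro a ha
        ext1 x
        rw [tr a _ ha, hm0]; simp
      rcases h1 with h1 | h1 <;> rcases h2 with h2 | h2
      · exact absurd (h1.trans h2.symm) hkk
      · have hts : k' ≠ s := fun h => hkk (h1.trans h.symm)
        refine fin 1 fun x => ?_
        have hts' : t ≠ s := h2 ▸ hts
        simp [ff, h1, h2, hts', add_comm]
      · have hts : k ≠ s := fun h => hkk (h.trans h2.symm)
        refine fin (-1) fun x => ?_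
        have hts' : t ≠ s := h1 ▸ hts
        simp [ff, h1, h2, hts']
        ring
      · exact absurd (h1.trans h2.symm) hkk
    · have : ff m s t k' = 1 := by
        unfold ff; push Not at h2; simp [h2.1, h2.2]
      rw [this, one_mul, inv]
  · have : ff m s t k = 1 := by
      unfold ff; push Not at h1; simp [h1.1, h1.2]
    rw [this, mul_one, inv]

theorem dn0 (hg : 0 < g) (S : SD g G A) (m : ℕ) (s t : ZMod (4*g)) (hst : s ≠ t) (j : ℕ)
    (hm : (2*g + s - t = 1 ∨ 2*g + s - t = -1) → ((2*g : ℕ) : ZMod m) = 0)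
    (h : ev A (ap s (2*g + s - t) j) = ev A (ap t (-(2*g + s - t)) j)) :
    (j : ZMod m) = 0 := by
  have h4g := h4 g
  generalize hd : 2*g + s - t = d at *
  let X := ZMod m × ℤˣ × ZMod (4*g)
  let c : ℤˣ → ZMod (4*g) := fun e => ((e : ℤ) : ZMod (4*g))
  have hc : ∀ e, c e = 1 ∨ c e = -1 := by
    intro e
    rcases Int.units_eq_one_or e with rfl | rfl <;> simp [c]
  have hcn : ∀ e, c (-e) = - c e := by intro e; simp [c]
  have hc2 : ∀ e, c e * (4*g) = 0 := by intro e; rw [h4g, mul_zero]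
  let act : ZMod (4*g) → X → X := fun i p =>
    (ff m s t (c p.2.1 * i + p.2.2) p.1, -p.2.1, p.2.2 + c p.2.1 * (2*i + 2*g))
  have act_inv : ∀ i p, act i (act (i + 2*g) p) = p := by
    rintro i ⟨x, e, r⟩
    simp only [act, hcn, neg_neg]
    refine Prod.ext ?_ (Prod.ext rfl ?_)
    · show ff m s t _ (ff m s t _ x) = x
      rw [← Equiv.Perm.mul_apply]
      rw [show -c e * i + (r + c e * (2 * (i + 2 * ↑g) + 2 * ↑g)) = c e * (i + 2*g) + r by
        linear_combination hc2 e, ff_sq]; rfl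
    · show r + c e * (2 * (i + 2 * ↑g) + 2 * ↑g) + -c e * (2 * i + 2 * ↑g) = r
      linear_combination hc2 e
  have e4 : ∀ i : ZMod (4*g), i + 2*g + 2*g = i := fun i => by linear_combination h4g
  let F : ZMod (4*g) → Equiv.Perm X := fun i =>
    { toFun := act i
      invFun := act (i + 2*g)
      left_inv := by
        intro p
        have := act_inv (i+2*g) p
        rwa [e4] at this
      right_inv := act_inv i }
  have hF : ∀ i, F (i + 2*g) = (F i)⁻¹ := by
    intro i; ext1 p; rfl
  have pair : ∀ i d x e r, F i (F (i + d) (x, e, r)) =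
      ((ff m s t (c e * (i + d) + r + c e * (d + 2*g)) * ff m s t (c e * (i + d) + r)) x, e,
        r + 2 * c e * d) := by
    intro i d x e r
    show act i (act (i + d) (x, e, r)) = _
    simp only [act, hcn, neg_neg]
    refine Prod.ext ?_ (Prod.ext rfl ?_)
    · show ff m s t _ (ff m s t _ x) = _
      rw [Equiv.Perm.mul_apply]
      congr 2; ring
    · simp only; ring
  have evpair : ∀ (i d : ZMod (4*g)) (l : ℕ) x, ev F (ap i d (2*(l+1))) x =
      ev F (ap i d (2*l)) (F (i + (2*l : ℕ)*d) (F ((i + (2*l : ℕ)*d) + d) x)) := by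
    intro i d l x
    rw [show 2*(l+1) = 2*l+1+1 by ring, ap_succ_right, ap_succ_right]
    simp only [ev_append, ev_cons, ev_nil, mul_one, Equiv.Perm.mul_apply]
    congr 3
    push_cast; ring_nf
  have evrel : ∀ (l : ℕ) (i k r : ZMod (4*g)) x e, k = c e * (i + 2*l - 1) + r →
      ev F (ap i 1 (2*l)) (x, e, r) =
      (((ff m s t (k + c e * (1 + 2*g)) * ff m s t k)^l) x, e, r + 2 * l * c e) := by
    intro l
    induction l with
    | zero => intro i k r x e hk; simp [ap]
    | succ l ih =>
      intro i k r x e hk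
      rw [evpair, pair, ih i k]
      · have hk2 : c e * (i + (2*l : ℕ) * 1 + 1) + r = k := by rw [hk]; push_cast; ring
        rw [hk2, pow_succ, Equiv.Perm.mul_apply]
        refine Prod.ext rfl (Prod.ext rfl ?_)
        simp only; push_cast; ring
      · rw [hk]; push_cast; ring
  have rel : ev F (ap 0 1 (4*g)) = 1 := by
    have e : 2*(2*g) = 4*g := by ring
    have h' : ap (0 : ZMod (4*g)) 1 (2*(2*g)) = ap 0 1 (4*g) := congrArg (ap 0 1) e
    rw [← h']
    ext1 ⟨x, e, r⟩
    rw [evrel (2*g) 0 _ r x e rfl, ff_order m s t _ _ (c e) (hc e) (by rw [hd]; exact hm) rfl]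
    simp only [Equiv.Perm.one_apply]
    congr 2
    push_cast
    linear_combination hc2 e
  obtain ⟨φ, hφ⟩ := S.lift _ F hF rel
  have hφ' : ∀ l, φ (ev A l) = ev F l := by
    intro l
    induction l with
    | nil => simp
    | cons a l ih => simp [ih, hφ]
  have hone : ev F (ap (s - j*d) d (2*j)) = 1 := by
    rw [← hφ', two_mul, ap_add, ev_append]
    rw [show s - j*d + j*d = s by ring, h]
    have := inv_ap S.inv t (-d) j
    rw [neg_neg] at this
    rw [show s - j*d = t + j * -d - -d + 2*g by rw [← hd]; linear_combination -h4g, ← this]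
    simp
  have evd : ∀ (j : ℕ) (i r : ZMod (4*g)) x, r + i + 2*j*d - d = t →
      ev F (ap i d (2*j)) (x, 1, r) = (x - j, 1, r + 2*j*d) := by
    intro j
    induction j with
    | zero => intro i r x _; simp [ap]
    | succ j ih =>
      intro i r x hr
      have c1 : c 1 = 1 := by simp [c]
      push_cast at hr
      rw [evpair, pair, c1, ih]
      · have k1 : (1 * (i + (2*j : ℕ) * d + d) + r : ZMod (4*g)) = t := by
          rw [← hr]; push_cast; ring
        rw [k1]
        have k2 : t + 1 * (d + 2*g) = s := by rw [← hd]; linear_combination h4g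
        rw [k2]
        refine Prod.ext ?_ (Prod.ext rfl ?_)
        · have hts : t ≠ s := hst.symm
          simp [ff, hts]
          ring
        · simp only; push_cast; ring
      · linear_combination hr
  have h3 := evd j (s - j*d) (t - s - j*d + d) 0 (by ring)
  rw [hone] at h3
  have := congrArg Prod.fst h3
  simpa using this

theorem dn (hg : 0 < g) (S : SD g G A) (s t : ZMod (4*g)) (hst : s ≠ t) (j : ℕ) (hj : 0 < j)
    (h : ev A (ap s (2*g + s - t) j) = ev A (ap t (-(2*g + s - t)) j)) :
    (2*g + s - t = 1 ∨ 2*g + s - t = -1) ∧ 2*g ≤ j := by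
  by_cases hd : (2*g + s - t = 1 ∨ 2*g + s - t = -1)
  · refine ⟨hd, ?_⟩
    have := dn0 hg S (2*g) s t hst j (fun _ => ZMod.natCast_self _) h
    rw [ZMod.natCast_eq_zero_iff] at this
    exact Nat.le_of_dvd hj this
  · have := dn0 hg S 0 s t hst j (fun h => absurd h hd) h
    rw [ZMod.natCast_eq_zero_iff] at this
    exact absurd (Nat.eq_zero_of_zero_dvd this) (by omega)

theorem Geo.of_eq {w w' : List (ZMod (4*g))} (hw : Geo A w) (h : ev A w' = ev A w)
    (hl : w'.length = w.length) : Geo A w' := by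
  intro l hl'
  rw [hl]
  exact hw l (hl'.trans h)

theorem step (hg : 0 < g) (S : SD g G A) (s t d : ZMod (4*g)) (hst : s ≠ t)
    (hd : d = 2*g + s - t) (k : ℕ) (hk : (d = 1 ∨ d = -1) → k < 2*g)
    (v v' : List (ZMod (4*g))) (hw : Geo A (ap s d k ++ v))
    (hv : ev A (t :: v') = ev A (ap s d k ++ v))
    (hl : (t :: v').length = (ap s d k ++ v).length) :
    ∃ v'', ev A (ap t (-d) (k+1) ++ v'') = ev A (ap s d k ++ v) ∧
      (ap t (-d) (k+1) ++ v'').length = (ap s d k ++ v).length := by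
  obtain ⟨u, i, u', hu, he⟩ := exchange hg S _ v' t hw hv hl
  have h4g := h4 g
  have hmap : ∀ j, (ap s d j).map (fun k => 2*t+2*g-k) = ap (t + -d) (-d) j := by
    intro j
    rw [map_ap]
    congr 1
    rw [hd]; linear_combination h4g
  have good : ∀ a', u = ap s d k ++ a' → v = a' ++ i :: u' →
    ∃ v'', ev A (ap t (-d) (k+1) ++ v'') = ev A (ap s d k ++ v) ∧
      (ap t (-d) (k+1) ++ v'').length = (ap s d k ++ v).length := by
    intro a' h1 h2
    refine ⟨a'.map (fun k => 2*t+2*g-k) ++ u', ?_, ?_⟩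
    · rw [hu]
      simp only [ev_append, ev_cons]
      rw [← mul_assoc (ev A u), ← he, h1, List.map_append, hmap]
      simp [ap, mul_assoc]
    · subst h2
      simp [ap_length]; omega
  rcases List.append_eq_append_iff.1 hu with ⟨a', h1, h2⟩ | ⟨c', h1, h2⟩
  · exact good a' h1 h2
  · rcases c' with _ | ⟨i', c''⟩
    · exact good [] (by simpa using h1.symm) (by simpa using h2.symm)
    · exfalso
      obtain ⟨rfl, rfl⟩ : i = i' ∧ u' = c'' ++ v := by simpa using h2
      have hlen := congrArg List.length h1
      simp [ap_length] at hlen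
      have h3 : ap s d k = ap s d (u.length + 1) ++ ap (s + (u.length + 1 : ℕ) * d) d c''.length := by
        rw [← ap_add]; congr 1; omega
      have h1' : (u ++ [i]) ++ c'' = ap s d (u.length + 1) ++
          ap (s + (u.length + 1 : ℕ) * d) d c''.length := by
        rw [← h3, h1]; simp
      have h4 := (List.append_inj h1' (by simp [ap_length])).1
      have h5 : u = ap s d u.length := by
        rw [ap_succ_right] at h4
        exact (List.append_inj h4 (by simp [ap_length])).1
      have h6 : ev A (ap s d (u.length + 1)) = ev A (ap t (-d) (u.length+1)) := by
        rw [← h4, ev_append]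
        simp only [ev_cons, ev_nil, mul_one, ap]
        rw [← he, ← hmap, ← h5]
      rw [hd] at h6
      have h7 := dn hg S s t hst (u.length+1) (by omega) h6
      rw [← hd] at h7
      have := hk h7.1
      omega

theorem claim (hg : 2 ≤ g) (S : SD g G A) (s t d : ZMod (4*g)) (hst : s ≠ t)
    (hd : d = 2*g + s - t) (w v : List (ZMod (4*g))) (hw : Geo A (s :: w))
    (hv : ev A (t :: v) = ev A (s :: w)) (hl : v.length = w.length) (k : ℕ)
    (hk : (d = 1 ∨ d = -1) → k ≤ 2*g) :
    (∃ v', ev A (ap s d k ++ v') = ev A (s :: w) ∧ (ap s d k ++ v').length = (s :: w).length) ∨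
    (∃ v', ev A (ap t (-d) k ++ v') = ev A (s :: w) ∧
      (ap t (-d) k ++ v').length = (s :: w).length) := by
  have h4g := h4 g
  induction k with
  | zero => left; exact ⟨s :: w, by simp [ap], by simp [ap]⟩
  | succ k ih =>
    rcases ih (fun h => by have := hk h; omega) with ⟨v', h1, h2⟩ | ⟨v', h1, h2⟩
    · right
      obtain ⟨v'', h3, h4⟩ := step (by omega) S s t d hst hd k (fun h => by have := hk h; omega) v' v
        (hw.of_eq h1 h2) (by rw [hv, h1]) (by rw [h2]; simpa using hl)
      exact ⟨v'', h3.trans h1, h4.trans h2⟩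
    · left
      obtain ⟨v'', h3, h4⟩ := step (by omega) S t s (-d) hst.symm
        (by rw [hd]; linear_combination -h4g) k
        (fun h => by
          have := hk (by rcases h with h | h
                         · right; linear_combination -h
                         · left; linear_combination -h)
          omega) v' w
        (hw.of_eq h1 h2) (by rw [h1]) (by rw [h2])
      rw [neg_neg] at h3 h4
      exact ⟨v'', h3.trans h1, h4.trans h2⟩

theorem adj (hg : 2 ≤ g) (S : SD g G A) (s t d : ZMod (4*g)) (hst : s ≠ t)
    (hd : d = 2*g + s - t) (w v : List (ZMod (4*g))) (hw : Geo A (s :: w))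
    (hv : ev A (t :: v) = ev A (s :: w)) (hl : v.length = w.length) :
    d = 1 ∨ d = -1 := by
  by_contra hne
  rcases claim hg S s t d hst hd w v hw hv hl (w.length + 2) (fun h => absurd h hne) with
    ⟨v', _, h⟩ | ⟨v', _, h⟩ <;>
  · simp [ap_length] at h; omega

theorem three (hg : 2 ≤ g) (S : SD g G A) (s t d : ZMod (4*g)) (hst : s ≠ t)
    (hd : d = 2*g + s - t) (w v : List (ZMod (4*g))) (hw : Geo A (s :: w))
    (hv : ev A (t :: v) = ev A (s :: w)) (hl : v.length = w.length) :
    ∃ v', ev A (s :: (s + d) :: (s + d + d) :: v') = ev A (s :: w) ∧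
      (s :: (s + d) :: (s + d + d) :: v').length = (s :: w).length := by
  have h4g := h4 g
  rcases claim hg S s t d hst hd w v hw hv hl 3 (fun _ => by omega) with
    ⟨v', h1, h2⟩ | ⟨v', h1, h2⟩
  · exact ⟨v', h1, h2⟩
  · obtain ⟨v'', h3, h4⟩ := step (by omega) S t s (-d) hst.symm
        (by rw [hd]; linear_combination -h4g) 3
        (fun _ => by omega) v' w
        (hw.of_eq h1 h2) (by rw [h1]) (by rw [h2])
    rw [neg_neg] at h3 h4
    exact ⟨(s + d + d + d) :: v'', h3.trans h1, h4.trans h2⟩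

theorem Geo.tail {a : ZMod (4*g)} {w : List (ZMod (4*g))} (hw : Geo A (a :: w)) : Geo A w := by
  intro l hl
  have := hw (a :: l) (by simp [hl])
  simpa using this

theorem bigon (hg : 2 ≤ g) (S : SD g G A) (s t d : ZMod (4*g)) (hst : s ≠ t)
    (hd : d = 2*g + s - t) (w v : List (ZMod (4*g))) (hw : Geo A (s :: w))
    (hv : ev A (t :: v) = ev A (s :: w)) (hl : v.length = w.length) :
    (d = 1 ∨ d = -1) ∧ ∃ w', w = (s + d) :: w' := by
  have h4g := h4 g
  have hd1 := adj hg S s t d hst hd w v hw hv hl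
  refine ⟨hd1, ?_⟩
  obtain ⟨v', h1, h2⟩ := three hg S s t d hst hd w v hw hv hl
  rcases w with _ | ⟨x, w'⟩
  · simp at h2
  refine ⟨w', ?_⟩
  by_contra hne
  have hx : s + d ≠ x := fun h => hne (by rw [h])
  have hG : Geo A ((s+d) :: (s+d+d) :: v') := (hw.of_eq h1 h2).tail
  have h1' : ev A (x :: w') = ev A ((s+d) :: (s+d+d) :: v') := by
    rw [ev_cons A s, ev_cons A s] at h1
    exact (mul_left_cancel h1).symm
  have hl' : w'.length = ((s+d+d) :: v').length := by simp at h2 ⊢; omega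
  have hη := adj hg S (s+d) x _ hx rfl _ w' hG h1' hl'
  obtain ⟨v3, h3, h4⟩ := three hg S (s+d) x _ hx rfl _ w' hG h1' hl'
  generalize he : 2*g + (s+d) - x = e at *
  rw [ev_cons A (s+d), ev_cons A (s+d)] at h3
  have h3' := mul_left_cancel h3
  have hG2 := hG.tail
  by_cases heq : s + d + d = s + d + e
  · have hed : e = d := by linear_combination -heq
    have hxs : x = s + 2*g := by rw [← hed] at he; linear_combination -he
    have := hw w' (by simp [hxs, S.inv])
    simp at this
  · have hadj := adj hg S (s+d+d) (s+d+e) _ heq rfl v' _ hG2 h3' (by simp at h4 ⊢; omega)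
    have hz : (2:ℕ) ∣ 4*g := ⟨2*g, by ring⟩
    have par : ∀ a : ZMod (4*g), a = 1 ∨ a = -1 → ZMod.castHom hz (ZMod 2) a = 1 := by
      rintro a (rfl | rfl)
      · exact map_one _
      · rw [map_neg, map_one]; decide
    have p1 := par _ hadj
    have p2 := par _ hd1
    have p3 := par _ hη
    simp only [map_add, map_sub, map_mul, p2, p3] at p1
    have h2 : (ZMod.castHom hz (ZMod 2)) 2 = 0 := by
      rw [map_ofNat]; rfl
    rw [h2] at p1
    have : (0 : ZMod 2) = 1 := by linear_combination p1
    exact absurd this (by decide)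

end main
end SGP

namespace SG
open SGP

/-- Index of a letter in the cyclic order given by the relator. -/
def idx (g : ℕ) (a : Letter g) : ZMod (4*g) :=
  if a.2 then ((a.1 : ℕ) : ZMod (4*g)) else ((a.1 : ℕ) : ZMod (4*g)) + 2*g

theorem idx_surj (g : ℕ) (hg : 0 < g) : Function.Surjective (idx g) := by
  have : NeZero (4*g) := ⟨by omega⟩
  intro z
  by_cases hz : z.val < 2*g
  · exact ⟨(⟨z.val, hz⟩, true), by simp [idx]⟩
  · have h1 := ZMod.val_lt z
    refine ⟨(⟨z.val - 2*g, by omega⟩, false), ?_⟩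
    have h2 : ((z.val - 2*g + 2*g : ℕ) : ZMod (4*g)) = z := by
      rw [Nat.sub_add_cancel (by omega)]; simp
    push_cast at h2
    simpa [idx] using h2

theorem idx_inj (g : ℕ) (hg : 0 < g) : Function.Injective (idx g) := by
  have : NeZero (4*g) := ⟨by omega⟩
  have := (idx_surj g hg).bijective_of_nat_card_le (by simp [Nat.card_eq_fintype_card, ZMod.card]; omega)
  exact this.1

theorem idx_inv (g : ℕ) (a : Letter g) : idx g (invLetter g a) = idx g a + 2*g := by
  have h4g := h4 g
  rcases a with ⟨i, _ | _⟩
  · simp [idx, invLetter]; linear_combination -h4g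
  · simp [idx, invLetter]

theorem evalLetter_inv (g : ℕ) (a : Letter g) :
    evalLetter g (invLetter g a) = (evalLetter g a)⁻¹ := by
  rcases a with ⟨i, _ | _⟩ <;> simp [evalLetter, invLetter]

/-- The letter with a given index. -/
noncomputable def lt (g : ℕ) (hg : 0 < g) (z : ZMod (4*g)) : Letter g :=
  (idx_surj g hg z).choose

theorem idx_lt (g : ℕ) (hg : 0 < g) (z : ZMod (4*g)) : idx g (lt g hg z) = z :=
  (idx_surj g hg z).choose_spec

theorem lt_idx (g : ℕ) (hg : 0 < g) (a : Letter g) : lt g hg (idx g a) = a :=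
  idx_inj g hg (idx_lt g hg _)

/-- The group elements of the generators, cyclically indexed. -/
noncomputable def AA (g : ℕ) (hg : 0 < g) (z : ZMod (4*g)) : SurfaceGroup g :=
  evalLetter g (lt g hg z)

theorem ev_AA (g : ℕ) (hg : 0 < g) (W : Word g) : ev (AA g hg) (W.map (idx g)) = eval g W := by
  simp only [ev, eval, List.map_map]
  congr 2
  ext1 a
  simp [AA, lt_idx]

theorem ap_ofFn {g : ℕ} (i : ZMod (4*g)) (j : ℕ) :
    ap i 1 j = List.ofFn fun k : Fin j => i + ((k : ℕ) : ZMod (4*g)) := by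
  induction j generalizing i with
  | zero => simp [ap]
  | succ j ih =>
    rw [List.ofFn_succ]
    simp only [ap, ih]
    congr 1
    · simp
    · congr 1; ext1 k; simp; ring

theorem Rword_idx (g : ℕ) : (Rword g).map (idx g) = ap 0 1 (4*g) := by
  rw [ap4, ap_ofFn, ap_ofFn, Rword, List.map_append, List.map_ofFn, List.map_ofFn]
  congr 2
  · ext1 k; simp [idx]
  · ext1 k; simp [idx]; ring

theorem hom_relator (g : ℕ) {H : Type} [Group H] (φ : FreeGroup (Fin (2*g)) →* H) :
    φ (relator g) = (List.ofFn fun i : Fin (2*g) => φ (FreeGroup.of i)).prod *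
      (List.ofFn fun i : Fin (2*g) => (φ (FreeGroup.of i))⁻¹).prod := by
  rw [relator, map_mul, map_list_prod, map_list_prod, List.map_ofFn, List.map_ofFn]
  simp [Function.comp_def]

theorem sd (g : ℕ) (hg : 0 < g) : SD g (SurfaceGroup g) (AA g hg) where
  inv i := by
    obtain ⟨a, rfl⟩ := idx_surj g hg i
    rw [← idx_inv]
    simp only [AA, lt_idx, evalLetter_inv]
  rel0 := by
    rw [← Rword_idx, ev_AA]
    have h : PresentedGroup.mk {relator g} (relator g) = 1 :=
      PresentedGroup.one_of_mem (Set.mem_singleton _)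
    have h2 := hom_relator g (PresentedGroup.mk {relator g})
    rw [← h, h2]
    simp only [eval, Rword, List.map_append, List.prod_append, List.map_ofFn]
    rfl
  gen x := by
    suffices h : ∃ W : Word g, eval g W = x by
      obtain ⟨W, rfl⟩ := h
      exact ⟨W.map (idx g), ev_AA g hg W⟩
    induction x using PresentedGroup.induction_on with
    | _ f =>
    refine FreeGroup.induction_on f ?_ ?_ ?_ ?_
    · exact ⟨[], by simp [eval]⟩
    · intro i; exact ⟨[(i, true)], by simp [eval, evalLetter, gen]; rfl⟩
    · intro i _; exact ⟨[(i, false)], by simp [eval, evalLetter, gen]; rfl⟩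
    · intro a b ha hb
      obtain ⟨u, hu⟩ := ha
      obtain ⟨v, hv⟩ := hb
      refine ⟨u ++ v, ?_⟩
      rw [map_mul, ← hu, ← hv]
      simp [eval]
  lift H _ F hF hr := by
    have hrel : ∀ r ∈ ({relator g} : Set (FreeGroup (Fin (2*g)))),
        FreeGroup.lift (fun i => F (idx g (i, true))) r = 1 := by
      rintro r rfl
      rw [← hr, ← Rword_idx]
      simp only [ev, Rword, relator, List.map_append, List.prod_append, map_mul, map_list_prod,
        List.map_ofFn]
      congr 3
      · ext1 k; simp
      · ext1 k
        simp only [Function.comp_apply, map_inv, FreeGroup.lift_apply_of]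
        rw [← hF, ← idx_inv]; rfl
    refine ⟨PresentedGroup.toGroup hrel, fun i => ?_⟩
    obtain ⟨a, rfl⟩ := idx_surj g hg i
    simp only [AA, lt_idx]
    rcases a with ⟨i, _ | _⟩
    · simp only [evalLetter, gen, Bool.false_eq_true, if_false, map_inv, PresentedGroup.toGroup.of]
      rw [← hF, ← idx_inv]; rfl
    · simp [evalLetter, gen]

theorem ap_rotate {g : ℕ} (hg : 0 < g) (i d : ZMod (4*g)) (n : ℕ) :
    (ap i d (4*g)).rotate n = ap (i + n*d) d (4*g) := by
  induction n with
  | zero => simp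
  | succ n ih =>
    rw [← List.rotate_rotate, ih]
    obtain ⟨k, hk⟩ : ∃ k, 4*g = k+1 := ⟨4*g-1, by omega⟩
    have hk' : (k : ZMod (4*g)) + 1 = 0 := by
      have := ZMod.natCast_self (4*g)
      conv at this => lhs; arg 1; rw [hk]
      push_cast at this; exact this
    have e1 : ∀ i : ZMod (4*g), ap i d (4*g) = ap i d (k+1) := fun i => congrArg (ap i d) hk
    rw [e1 (i + n*d), e1 (i + ((n+1 : ℕ) : ZMod (4*g))*d),
      ap_succ_right (i + ((n+1 : ℕ) : ZMod (4*g))*d)]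
    simp only [ap, List.rotate_cons_succ, List.rotate_zero]
    have e2 : i + ((n+1 : ℕ) : ZMod (4*g))*d = i + n*d + d := by push_cast; ring
    have e3 : i + n*d + d + k*d = i + n*d := by linear_combination d * hk'
    rw [e2, e3]

theorem ap_reverse {g : ℕ} (i d : ZMod (4*g)) (j : ℕ) :
    (ap i d j).reverse = ap (i + j*d - d) (-d) j := by
  induction j generalizing i with
  | zero => rfl
  | succ j ih =>
    rw [ap_succ_right (i + _ - _)]
    simp only [ap, List.reverse_cons, ih]
    congr 2
    · push_cast; ring
    · congr 1; push_cast; ring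

theorem ap_range {g : ℕ} (i d : ZMod (4*g)) (j : ℕ) :
    ap i d j = (List.range j).map fun k : ℕ => i + (k : ZMod (4*g)) * d := by
  induction j with
  | zero => rfl
  | succ j ih => rw [ap_succ_right, ih, List.range_succ]; simp

theorem relSeq_idx (g : ℕ) (hg : 0 < g) (b : ℕ → Letter g) (hb : RelSeq g b) :
    ∃ c e : ZMod (4*g), (e = 1 ∨ e = -1) ∧ ∀ j, 1 ≤ j → idx g (b j) = c + j * e := by
  have h4g := h4 g
  obtain ⟨hper, hR⟩ := hb
  have key : ∃ c e : ZMod (4*g), (e = 1 ∨ e = -1) ∧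
      (seg g b 1 (4*g)).map (idx g) = ap c e (4*g) := by
    rcases hR with ⟨n, hn⟩ | ⟨n, hn⟩
    · refine ⟨0 + n*1, 1, Or.inl rfl, ?_⟩
      rw [← hn, List.map_rotate, Rword_idx, ap_rotate hg]
    · refine ⟨0 + 2*g + (4*g : ℕ) * 1 - 1 + n * (-1), -1, Or.inr rfl, ?_⟩
      rw [← hn, List.map_rotate]
      have : (wordInv g (Rword g)).map (idx g) = (ap ((0 : ZMod (4*g)) + 2*g) 1 (4*g)).reverse := by
        rw [wordInv, List.map_reverse, List.map_map]
        have h1 : (idx g ∘ invLetter g) = (fun z : ZMod (4*g) => z + 2*g) ∘ idx g := by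
          ext1 a; simp [idx_inv]
        rw [h1, ← List.map_map, Rword_idx, ap_range, ap_range, List.map_map]
        congr 2
        ext1 k; simp; ring
      rw [this, ap_reverse, ap_rotate hg]
  obtain ⟨c, e, he, hs⟩ := key
  refine ⟨c - e, e, he, ?_⟩
  have small : ∀ k < 4*g, idx g (b (1 + k)) = c + k * e := by
    intro k hk
    rw [ap_range, seg, List.map_map] at hs
    have := List.map_inj_left.1 hs k (List.mem_range.2 hk)
    simpa using this
  have all : ∀ k, idx g (b (1 + k)) = c + k * e := by
    intro k
    induction k using Nat.strong_induction_on with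
    | _ k ih =>
      by_cases hk : k < 4*g
      · exact small k hk
      · have h1 := ih (k - 4*g) (by omega)
        have h2 := hper (1 + (k - 4*g))
        rw [show 1 + (k - 4*g) + 4*g = 1 + k by omega] at h2
        rw [h2, h1]
        have h3 : ((k - 4*g + 4*g : ℕ) : ZMod (4*g)) = k := by
          rw [Nat.sub_add_cancel (by omega)]
        push_cast at h3
        linear_combination e * h3 - e * h4g
  intro j hj
  have := all (j - 1)
  rw [show 1 + (j - 1) = j by omega] at this
  rw [this]
  have h3 : ((j - 1 + 1 : ℕ) : ZMod (4*g)) = j := by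
    rw [Nat.sub_add_cancel hj]
  push_cast at h3
  linear_combination e * h3

theorem lex_append (g : ℕ) (P Q W : Word g) (h : List.Lex (letterLt g) (P ++ Q) (P ++ W)) :
    List.Lex (letterLt g) Q W := by
  induction P with
  | nil => exact h
  | cons a P ih =>
    cases h with
    | cons h => exact ih h
    | rel h => exact absurd h (lt_irrefl (rank g a))

theorem irr_suffix (g : ℕ) (P Q : Word g) (h : IrreducibleWord g (P ++ Q)) :
    IrreducibleWord g Q := by
  intro W hW
  rcases h (P ++ W) (by simp only [eval, List.map_append, List.prod_append] at hW ⊢; rw [hW])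
    with h1 | h1 | ⟨h1, h2⟩
  · left; exact List.append_cancel_left h1
  · right; left; simpa using h1
  · right; right; exact ⟨by simpa using h1, lex_append g P Q W h2⟩

theorem irr_geo (g : ℕ) (hg : 0 < g) (W : Word g) (h : IrreducibleWord g W) :
    Geo (AA g hg) (W.map (idx g)) := by
  intro l hl
  have e1 : (l.map (lt g hg)).map (idx g) = l := by
    rw [List.map_map]
    conv_rhs => rw [← List.map_id l]
    congr 1
    ext1 z; simp [idx_lt]
  rw [← e1, ev_AA, ev_AA] at hl
  rcases h _ hl with h1 | h1 | h1
  · rw [← h1]; simp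
  · simp at h1 ⊢; omega
  · simp at h1 ⊢; omega

theorem semi (g : ℕ) (hg : 0 < g) (s e : ZMod (4*g)) (he : e = 1 ∨ e = -1) :
    ev (AA g hg) (ap s (-e) (2*g)) = ev (AA g hg) (ap (s + 2*g + e) e (2*g)) := by
  have h4g := h4 g
  have S := sd g hg
  rcases he with rfl | rfl
  · rw [← half_desc hg S.inv S.rel0]
    congr 2; linear_combination -h4g
  · have := half_desc hg S.inv S.rel0 (s - 1)
    rw [show s - 1 + 1 = s by ring] at this
    rw [neg_neg, ← this]
    congr 2; ring

theorem eval_append (g : ℕ) (W V : Word g) : eval g (W ++ V) = eval g W * eval g V := by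
  simp [eval]

theorem eval_wpow (g : ℕ) (W : Word g) (t : ℕ) : eval g (wpow g W t) = eval g W ^ t := by
  induction t with
  | zero => simp [wpow, eval]
  | succ t ih =>
    rw [pow_succ', ← ih, ← eval_append]
    simp [wpow, List.replicate_succ]

end SG

/-- If `X = b_{2g+1}(b_{2g}⋯b₂)^t X₁` is irreducible (where
`b₁⋯b_{4g} ∈ 𝓡`, `t ≥ 0`), then `Y = b_{2g+1}X₁` is irreducible. -/
theorem irreducible_drop_power (g : ℕ) (hg : 2 ≤ g) (b : ℕ → SG.Letter g)
    (hb : SG.RelSeq g b) (t : ℕ) (X₁ : SG.Word g)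
    (hX : SG.IrreducibleWord g
      ([b (2*g+1)] ++ SG.wpow g (SG.dseg g b (2*g) (2*g-1)) t ++ X₁)) :
    SG.IrreducibleWord g ([b (2*g+1)] ++ X₁) := by
  open SG SGP in
  have hg0 : 0 < g := by omega
  rcases t with _ | t
  · simpa [wpow] using hX
  have S := sd g hg0
  have h4g := h4 g
  obtain ⟨c, e, he, hbi⟩ := relSeq_idx g hg0 b hb
  have hX1 : IrreducibleWord g X₁ := irr_suffix g _ _ hX
  have hXG := irr_geo g hg0 _ hX
  have hege : 2 * (g : ZMod (4*g)) * e = 2*g := by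
    rcases he with rfl | rfl
    · ring
    · linear_combination -h4g
  generalize hs : idx g (b (2*g+1)) = s at *
  have hs' := hbi (2*g+1) (by omega)
  push_cast at hs'
  rw [hs] at hs'
  set D := dseg g b (2*g) (2*g-1) with hD
  have hDi : D.map (idx g) = ap (s - e) (-e) (2*g-1) := by
    rw [hD, dseg, List.map_map, ap_range]
    apply List.map_congr_left
    intro k hk
    have hk := List.mem_range.1 hk
    have h1 := hbi (2*g + 4*g - k) (by omega)
    simp only [Function.comp_apply]
    rw [h1, Nat.cast_sub (by omega)]
    push_cast
    linear_combination (-1) * hs' + e * h4g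
  let β := lt g hg0 (s + 2*g + e)
  have hβ : idx g β = s + 2*g + e := idx_lt _ _ _
  let U : Word g := (ap (s + 2*g + e) e (2*g-1)).map (lt g hg0)
  have hmm : ∀ l : List (ZMod (4*g)), (l.map (lt g hg0)).map (idx g) = l := by
    intro l
    rw [List.map_map]
    conv_rhs => rw [← List.map_id l]
    congr 1
    ext1 z; simp [idx_lt]
  have hsemi : eval g ([b (2*g+1)] ++ D) = eval g (U ++ [b (2*g+1)]) := by
    rw [← ev_AA g hg0, ← ev_AA g hg0]
    have h1 := semi g hg0 s e he
    obtain ⟨k, hk⟩ : ∃ k, 2*g = k + 1 := ⟨2*g-1, by omega⟩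
    have hk' : ((2*g : ℕ) : ZMod (4*g)) = k + 1 := by rw [hk]; push_cast; rfl
    push_cast at hk'
    have h2 : (([b (2*g+1)] ++ D).map (idx g)) = ap s (-e) (2*g) := by
      rw [List.map_append, hDi, hk]
      simp only [List.map_cons, List.map_nil, ap, Nat.add_sub_cancel]
      rw [← hk, hs, sub_eq_add_neg]; rfl
    have h3 : ((U ++ [b (2*g+1)]).map (idx g)) = ap (s + 2*g + e) e (2*g) := by
      rw [List.map_append, hmm, hk, ap_succ_right]
      simp only [List.map_cons, List.map_nil, Nat.add_sub_cancel]
      rw [← hk, hs]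
      congr 2
      linear_combination e * hk' - hege - h4g
    rw [h2, h3, h1]
  have hUlen : U.length = 2*g-1 := by simp [U, ap_length]
  have hDlen : D.length = 2*g-1 := by simp [hD, dseg]
  have wlen : ∀ (W : Word g) n, (wpow g W n).length = n * W.length := by
    intro W n; simp [wpow]
  have hsemit : ∀ n, eval g ([b (2*g+1)] ++ wpow g D n) = eval g (wpow g U n ++ [b (2*g+1)]) := by
    intro n
    rw [eval_append] at hsemi ⊢
    rw [eval_append] at hsemi ⊢
    rw [eval_wpow, eval_wpow]
    exact SemiconjBy.pow_right hsemi n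
  -- Y is geodesic
  have hYG : Geo (AA g hg0) (([b (2*g+1)] ++ X₁).map (idx g)) := by
    intro l hl
    rw [← hmm l, ev_AA, ev_AA] at hl
    have h1 := hXG ((wpow g U (t+1) ++ l.map (lt g hg0)).map (idx g)) (by
      rw [ev_AA, ev_AA, eval_append, hl, eval_append, ← mul_assoc, ← eval_append, ← hsemit,
        ← eval_append])
    simp [wlen, hUlen, hDlen] at h1 ⊢
    omega
  have hpar : s ≠ s + 2*g + e := by
    intro h
    have hz : (2:ℕ) ∣ 4*g := ⟨2*g, by ring⟩
    have h0 : 2*(g : ZMod (4*g)) + e = 0 := by linear_combination -h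
    have h1 := congrArg (ZMod.castHom hz (ZMod 2)) h0
    have h2 : (ZMod.castHom hz (ZMod 2)) 2 = 0 := by
      rw [map_ofNat]; rfl
    rw [map_add, map_mul, h2, map_zero, zero_mul, zero_add] at h1
    rcases he with rfl | rfl
    · rw [map_one] at h1; exact absurd h1 (by decide)
    · rw [map_neg, map_one] at h1; exact absurd h1 (by decide)
  have hUcons : ∃ U', U = β :: U' := by
    obtain ⟨k, hk⟩ : ∃ k, 2*g - 1 = k + 1 := ⟨2*g-2, by omega⟩
    refine ⟨(ap (s + 2*g + e + e) e k).map (lt g hg0), ?_⟩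
    simp only [U, β]
    rw [hk]; rfl
  obtain ⟨U', hU'⟩ := hUcons
  -- the first letter of X precedes b₂
  have hrank : rank g (b (2*g+1)) < rank g β := by
    have h1 := hX (U ++ [b (2*g+1)] ++ wpow g D t ++ X₁) (by
      rw [eval_append, eval_append _ _ X₁, eval_append, ← hsemi, ← eval_append, List.append_assoc]
      simp [wpow, List.replicate_succ])
    rcases h1 with h1 | h1 | ⟨_, h1⟩
    · rw [hU'] at h1
      simp only [List.cons_append, List.nil_append] at h1
      have := (List.cons.inj h1).1
      exact absurd (by rw [← hβ, this, hs]) hpar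
    · simp [wlen, hUlen, hDlen] at h1
      have : (t+1) * (2*g-1) = t*(2*g-1) + (2*g-1) := by ring
      omega
    · rw [hU'] at h1
      simp only [List.cons_append, List.nil_append] at h1
      have hlex : ∀ (a a' : Letter g) (l l' : Word g),
          List.Lex (letterLt g) (a :: l) (a' :: l') → a = a' ∨ letterLt g a a' := by
        intro a a' l l' h
        cases h with
        | cons h => exact Or.inl rfl
        | rel h => exact Or.inr h
      rcases hlex _ _ _ _ h1 with h | h
      · exact absurd (by rw [← hβ, ← h, hs]) hpar
      · exact h
  -- D ends in b₂
  have hDlast : ∃ D', D = D' ++ [β] := by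
    obtain ⟨k, hk⟩ : ∃ k, 2*g - 1 = k + 1 := ⟨2*g-2, by omega⟩
    have hk' : ((2*g : ℕ) : ZMod (4*g)) = k + 2 := by
      rw [show 2*g = k+2 by omega]; push_cast; rfl
    push_cast at hk'
    refine ⟨(ap (s - e) (-e) k).map (lt g hg0), ?_⟩
    apply (idx_inj g hg0).list_map
    rw [hDi, hk, ap_succ_right, List.map_append, hmm]
    simp only [List.map_cons, List.map_nil, hβ]
    congr 2
    linear_combination e * hk' - hege - h4g
  obtain ⟨D', hD'⟩ := hDlast
  have hXred : ∀ x X', X₁ = x :: X' → idx g x ≠ s + e := by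
    intro x X' hx hxs
    have hxβ : x = invLetter g β := by
      apply idx_inj g hg0
      rw [idx_inv, hβ, hxs]; linear_combination -h4g
    have hw : wpow g D (t+1) = wpow g D t ++ D' ++ [β] := by
      rw [wpow, List.replicate_succ', List.flatten_append, List.append_assoc, ← hD']
      simp [wpow]
    have h1 := hXG (([b (2*g+1)] ++ (wpow g D t ++ D') ++ X').map (idx g)) (by
      rw [ev_AA, ev_AA, hw, hx, hxβ]
      have : eval g (β :: invLetter g β :: X') = eval g X' := by
        simp [eval, evalLetter_inv]
      have h3 : [b (2*g+1)] ++ (wpow g D t ++ D' ++ [β]) ++ invLetter g β :: X' =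
        [b (2*g+1)] ++ (wpow g D t ++ D') ++ (β :: invLetter g β :: X') := by simp
      rw [h3, eval_append, eval_append _ _ (β :: _), this])
    rw [hw, hx] at h1
    simp at h1
  intro W hW
  have hlen : ([b (2*g+1)] ++ X₁).length ≤ W.length := by
    have := hYG (W.map (idx g)) (by rw [ev_AA, ev_AA, hW])
    simpa using this
  rcases hlen.lt_or_eq with hlt | hleq
  · right; left; exact hlt
  rcases W with _ | ⟨y, W⟩
  · simp at hleq
  by_cases hy : y = b (2*g+1)
  · subst hy
    have hW' : eval g W = eval g X₁ := by
      simpa [eval] using hW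
    rcases hX1 W hW' with h1 | h1 | ⟨h1, h2⟩
    · left; rw [h1]; rfl
    · simp at hleq; omega
    · right; right; exact ⟨hleq, List.Lex.cons h2⟩
  · by_cases hr : rank g (b (2*g+1)) < rank g y
    · right; right; exact ⟨hleq, List.Lex.rel hr⟩
    · exfalso
      have hsy : s ≠ idx g y := by
        rw [← hs]; intro h; exact hy (idx_inj g hg0 h).symm
      have hb1 := bigon hg S s (idx g y) _ hsy rfl (X₁.map (idx g)) (W.map (idx g))
        (by rw [← hs]; exact hYG)
        (by
          have : ev (AA g hg0) ((y :: W).map (idx g)) =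
            ev (AA g hg0) (([b (2*g+1)] ++ X₁).map (idx g)) := by rw [ev_AA, ev_AA, hW]
          rw [← hs]; exact this)
        (by simp at hleq ⊢; omega)
      generalize hd : 2*g + s - idx g y = d at *
      obtain ⟨hd1, w', hw'⟩ := hb1
      by_cases hde : d = e
      · rcases X₁ with _ | ⟨x, X'⟩
        · simp at hw'
        · apply hXred x X' rfl
          simp only [List.map_cons, List.cons.injEq] at hw'
          rw [hw'.1, hde]
      · have hde' : d = -e := by
          rcases he with rfl | rfl <;> rcases hd1 with rfl | rfl <;> simp_all
        have : y = β := by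
          apply idx_inj g hg0
          rw [hβ]; linear_combination -hd - hde'
        rw [this] at hr
        exact hr hrank
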